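/- Let S be a finite nonempty set, c a cost function, {i,j,k} ∈ binom(S,3), and R ⊆ S such that {i,j} ∈ δ(R) and {i,k} ∈ δ(R). If c_{ijk}^+ + c_{ij}^+ + c_{ik}^+ ≥ Σ_{{p,q,r}∈T_{δ(R)}} c_{pqr}^− + Σ_{{p,q}∈δ(R)} c_{pq}^−, then there exists an optimal solution x* of min_{x∈X_S} φ_c(x) such that x*_{ij}·x*_{ik}·x*_{jk} = 0. -/

import Mathlib

open Finset

/-- `binom(S,2)`: the set of 2-element subsets (unordered pairs) of the ground set. -/
def pairs (V : Type*) [Fintype V] [DecidableEq V] : Finset (Finset V) :=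
  (univ : Finset V).powersetCard 2

/-- `binom(S,3)`: the set of 3-element subsets (unordered triples) of the ground set. -/
def triples (V : Type*) [Fintype V] [DecidableEq V] : Finset (Finset V) :=
  (univ : Finset V).powersetCard 3

/-- The feasible set `X_S`: maps `x : binom(S,2) → {0,1}` satisfying the triangle
inequalities `x_{pq} + x_{qr} - x_{pr} ≤ 1` for all pairwise distinct `p, q, r`. -/
def feasible {V : Type*} [Fintype V] [DecidableEq V] (x : Finset V → ℝ) : Prop :=
  (∀ e ∈ pairs V, x e = 0 ∨ x e = 1) ∧
    ∀ p q r : V, p ≠ q → q ≠ r → p ≠ r →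
      x {p, q} + x {q, r} - x {p, r} ≤ 1

/-- The cubic objective
`φ_c(x) = Σ_{{p,q,r}} c_{pqr} x_{pq} x_{pr} x_{qr} + Σ_{{p,q}} c_{pq} x_{pq} + c_∅`. -/
def obj {V : Type*} [Fintype V] [DecidableEq V] (c x : Finset V → ℝ) : ℝ :=
  ∑ t ∈ triples V, c t * ∏ e ∈ t.powersetCard 2, x e
    + ∑ e ∈ pairs V, c e * x e + c ∅

/-- `δ(R)`: the pairs having exactly one element in `R`. -/
def cut {V : Type*} [Fintype V] [DecidableEq V] (R : Finset V) : Finset (Finset V) :=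
  (pairs V).filter fun e => (e ∩ R).card = 1

/-- `T_{P'}`: the triples having some 2-element subset in `P'`. -/
def Tof {V : Type*} [Fintype V] [DecidableEq V] (P' : Finset (Finset V)) :
    Finset (Finset V) :=
  (triples V).filter fun t => ∃ e ∈ t.powersetCard 2, e ∈ P'

theorem mem_cut_pair {V : Type*} [Fintype V] [DecidableEq V] (R : Finset V) {p q : V}
    (hpq : p ≠ q) : ({p, q} : Finset V) ∈ cut R ↔ (p ∈ R ↔ q ∉ R) := by
  by_cases hp : p ∈ R <;> by_cases hq : q ∈ R <;>
    simp [cut, pairs, mem_powersetCard, card_pair hpq, insert_inter_of_mem,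
      insert_inter_of_notMem, singleton_inter_of_mem, singleton_inter_of_notMem, hp, hq]

theorem pair_mem_pairs {V : Type*} [Fintype V] [DecidableEq V] {p q : V} (hpq : p ≠ q) :
    ({p, q} : Finset V) ∈ pairs V := by
  simp [pairs, mem_powersetCard, card_pair hpq]

theorem mem_pairs_of_mem_powersetCard {V : Type*} [Fintype V] [DecidableEq V]
    {e t : Finset V} (he : e ∈ t.powersetCard 2) : e ∈ pairs V :=
  mem_powersetCard.2 ⟨subset_univ e, (mem_powersetCard.1 he).2⟩

theorem feasible_congr {V : Type*} [Fintype V] [DecidableEq V] {x y : Finset V → ℝ}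
    (hxy : ∀ e ∈ pairs V, x e = y e) (hx : feasible x) : feasible y := by
  refine ⟨fun e he => hxy e he ▸ hx.1 e he, fun p q r hpq hqr hpr => ?_⟩
  rw [← hxy _ (pair_mem_pairs hpq), ← hxy _ (pair_mem_pairs hqr), ← hxy _ (pair_mem_pairs hpr)]
  exact hx.2 p q r hpq hqr hpr

theorem obj_congr {V : Type*} [Fintype V] [DecidableEq V] (c : Finset V → ℝ)
    {x y : Finset V → ℝ} (hxy : ∀ e ∈ pairs V, x e = y e) : obj c x = obj c y := by
  unfold obj
  congr 2
  · refine sum_congr rfl fun t _ => ?_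
    rw [prod_congr rfl fun e he => hxy e (mem_pairs_of_mem_powersetCard he)]
  · exact sum_congr rfl fun e he => by rw [hxy e he]

theorem exists_optimal {V : Type*} [Fintype V] [DecidableEq V] (c : Finset V → ℝ) :
    ∃ x : Finset V → ℝ, feasible x ∧ ∀ y, feasible y → obj c x ≤ obj c y := by
  classical
  let F : Set (Finset V → ℝ) := {x | feasible x ∧ ∀ e, x e ∈ ({0, 1} : Set ℝ)}
  have hfin : F.Finite :=
    (Set.Finite.pi' fun _ : Finset V => Set.toFinite ({0, 1} : Set ℝ)).subset fun x hx => hx.2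
  have hne : F.Nonempty := ⟨fun _ => 0, ⟨by simp, by simp⟩, by simp⟩
  obtain ⟨x, hx, hmin⟩ := Set.exists_min_image F (obj c) hfin hne
  refine ⟨x, hx.1, fun y hy => ?_⟩
  have hyz : ∀ e ∈ pairs V, y e = if y e = 1 then 1 else 0 := fun e he => by
    rcases hy.1 e he with h | h <;> simp [h]
  rw [obj_congr c hyz]
  refine hmin _ ⟨feasible_congr hyz hy, fun e => ?_⟩
  by_cases h : y e = 1 <;> simp [h]

/-- The elementary cut map: separate `R` from its complement by zeroing the pairs in `δ(R)`. -/
def cutMap {V : Type*} [Fintype V] [DecidableEq V] (R : Finset V) (x : Finset V → ℝ) :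
    Finset V → ℝ :=
  fun e => if e ∈ cut R then 0 else x e

theorem feasible_cutMap {V : Type*} [Fintype V] [DecidableEq V] (R : Finset V)
    {x : Finset V → ℝ} (hx : feasible x) : feasible (cutMap R x) := by
  refine ⟨fun e he => ?_, fun p q r hpq hqr hpr => ?_⟩
  · unfold cutMap
    split_ifs
    exacts [Or.inl rfl, hx.1 e he]
  · have key := hx.2 p q r hpq hqr hpr
    have bounds : ∀ e ∈ pairs V, 0 ≤ x e ∧ x e ≤ 1 := fun e he => by
      rcases hx.1 e he with h | h <;> simp [h]
    have bpq := bounds _ (pair_mem_pairs hpq)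
    have bqr := bounds _ (pair_mem_pairs hqr)
    have bpr := bounds _ (pair_mem_pairs hpr)
    simp only [cutMap, mem_cut_pair R hpq, mem_cut_pair R hqr, mem_cut_pair R hpr]
    by_cases hp : p ∈ R <;> by_cases hq : q ∈ R <;> by_cases hr : r ∈ R <;>
      simp [hp, hq, hr] <;> linarith

theorem obj_sub_obj_cutMap {V : Type*} [Fintype V] [DecidableEq V] (c x : Finset V → ℝ)
    (R : Finset V) :
    obj c x - obj c (cutMap R x) =
      ∑ t ∈ Tof (cut R), c t * ∏ e ∈ t.powersetCard 2, x e + ∑ e ∈ cut R, c e * x e := by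
  have htriples : ∑ t ∈ triples V, c t * ∏ e ∈ t.powersetCard 2, x e
      - ∑ t ∈ triples V, c t * ∏ e ∈ t.powersetCard 2, cutMap R x e
      = ∑ t ∈ Tof (cut R), c t * ∏ e ∈ t.powersetCard 2, x e := by
    rw [← sum_sub_distrib, Tof, sum_filter]
    refine sum_congr rfl fun t _ => ?_
    split_ifs with ht
    · obtain ⟨e, he, hec⟩ := ht
      rw [prod_eq_zero he (show cutMap R x e = 0 from if_pos hec)]
      ring
    · push Not at ht
      rw [prod_congr rfl fun e he => show cutMap R x e = x e from if_neg (ht e he)]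
      ring
  have hpairs : ∑ e ∈ pairs V, c e * x e - ∑ e ∈ pairs V, c e * cutMap R x e
      = ∑ e ∈ cut R, c e * x e := by
    have hsub : cut R ⊆ pairs V := filter_subset _ _
    rw [← sum_sub_distrib, ← sum_subset hsub fun e _ he => by simp [cutMap, he]]
    exact sum_congr rfl fun e he => by simp [cutMap, he]
  unfold obj
  linarith

theorem sum_posPart_le_sum_mul_add {α : Type*} {A B : Finset α} (hBA : B ⊆ A) (c w : α → ℝ)
    (hw0 : ∀ a ∈ A, 0 ≤ w a) (hw1 : ∀ a ∈ A, w a ≤ 1) (hB : ∀ a ∈ B, w a = 1) :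
    ∑ a ∈ B, max (c a) 0 ≤ ∑ a ∈ A, c a * w a + ∑ a ∈ A, max (-(c a)) 0 := by
  rw [← sum_add_distrib]
  refine (sum_le_sum fun a ha => ?_).trans (sum_le_sum_of_subset_of_nonneg hBA fun a ha _ => ?_)
  · rw [hB a ha]
    rcases le_total (c a) 0 with h | h <;> simp [h]
  · have h0 := hw0 a ha
    have h1 := hw1 a ha
    rcases le_total (c a) 0 with h | h
    · rw [max_eq_left (by linarith)]
      nlinarith
    · rw [max_eq_right (by linarith)]
      positivity

/--
Let `S` be a finite nonempty set, `c` a cost function,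
`{i,j,k} ∈ binom(S,3)`, and `R ⊆ S` such that `{i,j} ∈ δ(R)` and `{i,k} ∈ δ(R)`.
If `c_{ijk}⁺ + c_{ij}⁺ + c_{ik}⁺ ≥ Σ_{{p,q,r} ∈ T_{δ(R)}} c_{pqr}⁻ + Σ_{{p,q} ∈ δ(R)} c_{pq}⁻`,
then there exists an optimal solution `x*` of `min_{x ∈ X_S} φ_c(x)` such that
`x*_{ij} · x*_{ik} · x*_{jk} = 0`.
-/
theorem triplet_cut_persistency {V : Type*} [Fintype V] [DecidableEq V] [Nonempty V]
    (c : Finset V → ℝ) (i j k : V) (hij : i ≠ j) (hik : i ≠ k) (hjk : j ≠ k)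
    (R : Finset V)
    (hR1 : ({i, j} : Finset V) ∈ cut R) (hR2 : ({i, k} : Finset V) ∈ cut R)
    (h : max (c {i, j, k}) 0 + max (c {i, j}) 0 + max (c {i, k}) 0 ≥
        ∑ t ∈ Tof (cut R), max (-(c t)) 0 + ∑ e ∈ cut R, max (-(c e)) 0) :
    ∃ xstar : Finset V → ℝ, feasible xstar ∧
      (∀ x : Finset V → ℝ, feasible x → obj c xstar ≤ obj c x) ∧
      xstar {i, j} * xstar {i, k} * xstar {j, k} = 0 := by
  obtain ⟨x, hx, hopt⟩ := exists_optimal c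
  by_cases h0 : x {i, j} * x {i, k} * x {j, k} = 0
  · exact ⟨x, hx, hopt, h0⟩
  refine ⟨cutMap R x, feasible_cutMap R hx, fun y hy => le_trans ?_ (hopt y hy),
    by simp [cutMap, hR1]⟩
  obtain ⟨⟨hxij, hxik⟩, hxjk⟩ : (x {i, j} ≠ 0 ∧ x {i, k} ≠ 0) ∧ x {j, k} ≠ 0 := by
    simpa only [ne_eq, mul_eq_zero, not_or] using h0
  have eq_one : ∀ e ∈ pairs V, x e ≠ 0 → x e = 1 := fun e he => (hx.1 e he).resolve_left
  have bounds : ∀ e ∈ pairs V, 0 ≤ x e ∧ x e ≤ 1 := fun e he => by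
    rcases hx.1 e he with h | h <;> simp [h]
  have hpair : ∀ e ∈ ({i, j, k} : Finset V).powersetCard 2, x e = 1 := by
    intro e he
    refine eq_one e (mem_pairs_of_mem_powersetCard he) ?_
    obtain ⟨hsub, hcard⟩ := mem_powersetCard.1 he
    obtain ⟨a, b, hab, rfl⟩ := card_eq_two.1 hcard
    have ha : a ∈ ({i, j, k} : Finset V) := hsub (by simp)
    have hb : b ∈ ({i, j, k} : Finset V) := hsub (by simp)
    simp only [mem_insert, mem_singleton] at ha hb
    rcases ha with rfl | rfl | rfl <;> rcases hb with rfl | rfl | rfl <;>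
      first
        | exact absurd rfl hab
        | assumption
        | (rw [pair_comm]; assumption)
  have hmem : ({i, j, k} : Finset V) ∈ Tof (cut R) := by
    refine mem_filter.2 ⟨mem_powersetCard.2 ⟨subset_univ _, card_eq_three.2
      ⟨i, j, k, hij, hik, hjk, rfl⟩⟩, {i, j}, mem_powersetCard.2 ⟨?_, card_pair hij⟩, hR1⟩
    intro a
    simp only [mem_insert, mem_singleton]
    tauto
  have htriples := sum_posPart_le_sum_mul_add (singleton_subset_iff.2 hmem) c
    (fun t => ∏ e ∈ t.powersetCard 2, x e)
    (fun t _ => prod_nonneg fun e he => (bounds e (mem_pairs_of_mem_powersetCard he)).1)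
    (fun t _ => prod_le_one (fun e he => (bounds e (mem_pairs_of_mem_powersetCard he)).1)
      fun e he => (bounds e (mem_pairs_of_mem_powersetCard he)).2)
    (fun t ht => by rw [mem_singleton.1 ht]; exact prod_eq_one hpair)
  have hne : ({i, j} : Finset V) ≠ {i, k} := fun heq => by
    have hj : j ∈ ({i, k} : Finset V) := heq ▸ by simp
    simp [hij.symm, hjk] at hj
  have hpairs := sum_posPart_le_sum_mul_add (A := cut R) (B := {{i, j}, {i, k}})
    (insert_subset hR1 (singleton_subset_iff.2 hR2)) c x
    (fun e he => (bounds e (mem_filter.1 he).1).1) (fun e he => (bounds e (mem_filter.1 he).1).2)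
    (fun e he => by
      rcases mem_insert.1 he with rfl | he
      · exact eq_one _ (pair_mem_pairs hij) hxij
      · rw [mem_singleton.1 he]
        exact eq_one _ (pair_mem_pairs hik) hxik)
  rw [sum_singleton] at htriples
  rw [sum_pair hne] at hpairs
  linarith [obj_sub_obj_cutMap c x R]
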